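/- arXiv:2505.07370 — 2 statements merged into one kernel-verified Lean document; each statement's English description precedes it below -/
import Mathlib

section
/- Let V be a nonnegative random variable with E(V^2) < ∞. Then E[ sup_{t∈R} |Φ(t/V) − Φ(t)| ] ≤ (35/8) E|V^2 − 1|, where Φ(t/V) denotes the distribution function at t of a centered Gaussian with variance V^2 (equal to the indicator 1_{t ≥ 0} when V = 0) and Φ is the standard normal distribution function. -/
open MeasureTheory ProbabilityTheory Finset
open scoped NNReal ENNReal

/-- The distribution function at `t` of a centered Gaussian random variable
with variance `v` (for `v = 0` this is the distribution function of the Dirac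
mass at `0`). -/
noncomputable def gaussCDF (v : ℝ≥0) (t : ℝ) : ℝ :=
  ((gaussianReal 0 v) (Set.Iic t)).toReal

/-- The standard Gaussian density satisfies `|x| φ(x) ≤ 1`. -/
lemma abs_mul_gaussianPDFReal_le_one (x : ℝ) : |x| * gaussianPDFReal 0 1 x ≤ 1 := by
  have hc : (√(2 * Real.pi * (1 : ℝ≥0)))⁻¹ ≤ 1 := by
    apply inv_le_one_of_one_le₀
    rw [Real.one_le_sqrt]
    have := Real.pi_gt_three
    push_cast
    linarith
  have hx : |x| * Real.exp (-(x - 0) ^ 2 / (2 * (1 : ℝ≥0))) ≤ 1 := by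
    have h1 := Real.add_one_le_exp (x ^ 2 / 2)
    have h2 : -(x - 0) ^ 2 / (2 * ((1 : ℝ≥0) : ℝ)) = -(x ^ 2 / 2) := by
      push_cast
      ring
    rw [h2, Real.exp_neg, ← div_eq_mul_inv, div_le_one (Real.exp_pos _)]
    nlinarith [sq_nonneg (|x| - 1), sq_abs x]
  rw [gaussianPDFReal_def]
  calc |x| * ((√(2 * Real.pi * (1 : ℝ≥0)))⁻¹ * Real.exp (-(x - 0) ^ 2 / (2 * (1 : ℝ≥0))))
      = (√(2 * Real.pi * (1 : ℝ≥0)))⁻¹ *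
          (|x| * Real.exp (-(x - 0) ^ 2 / (2 * (1 : ℝ≥0)))) := by ring
    _ ≤ 1 := mul_le_one₀ hc (by positivity) hx

lemma abs_gaussCDF_sub_le_one (v w : ℝ≥0) (t : ℝ) : |gaussCDF v t - gaussCDF w t| ≤ 1 := by
  have h (u : ℝ≥0) : 0 ≤ gaussCDF u t ∧ gaussCDF u t ≤ 1 :=
    ⟨measureReal_nonneg, measureReal_le_one⟩
  rw [abs_le]
  constructor <;> linarith [(h v).1, (h v).2, (h w).1, (h w).2]

lemma gaussCDF_sq (s : ℝ) (hs : 0 < s) (t : ℝ) :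
    gaussCDF (Real.toNNReal (s ^ 2)) t = gaussCDF 1 (t / s) := by
  have hmap : (gaussianReal 0 1).map (s * ·) = gaussianReal 0 (Real.toNNReal (s ^ 2)) := by
    rw [gaussianReal_map_const_mul]
    congr 1
    · simp
    · ext
      simp [sq_nonneg]
  unfold gaussCDF
  rw [← hmap, Measure.map_apply (by fun_prop) measurableSet_Iic]
  congr 2
  ext x
  simp [le_div_iff₀ hs, mul_comm]

lemma abs_gaussCDF_one_sub_le_of_pdf_le {a b C : ℝ} (hab : a ≤ b) (hC : 0 ≤ C)
    (h : ∀ x ∈ Set.Ioc a b, gaussianPDFReal 0 1 x ≤ C) :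
    |gaussCDF 1 b - gaussCDF 1 a| ≤ C * (b - a) := by
  have hdiff : gaussCDF 1 b - gaussCDF 1 a = (gaussianReal 0 1).real (Set.Ioc a b) := by
    unfold gaussCDF
    rw [← Set.Iic_sdiff_Iic, measureReal_sdiff (Set.Iic_subset_Iic.2 hab) measurableSet_Iic]
    rfl
  rw [hdiff, abs_of_nonneg measureReal_nonneg]
  apply ENNReal.toReal_le_of_le_ofReal (mul_nonneg hC (sub_nonneg.2 hab))
  rw [gaussianReal_apply _ one_ne_zero]
  calc ∫⁻ x in Set.Ioc a b, gaussianPDF 0 1 x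
      ≤ ∫⁻ _ in Set.Ioc a b, ENNReal.ofReal C :=
        setLIntegral_mono measurable_const fun x hx => ENNReal.ofReal_le_ofReal (h x hx)
    _ = ENNReal.ofReal (C * (b - a)) := by
        rw [setLIntegral_const, Real.volume_Ioc, ← ENNReal.ofReal_mul hC]

/-- A Lipschitz bound for the standard Gaussian distribution function away from `0`. -/
lemma abs_gaussCDF_one_sub_le {a b m : ℝ} (hm : 0 < m)
    (h : ∀ x ∈ Set.uIcc a b, m ≤ |x|) :
    |gaussCDF 1 a - gaussCDF 1 b| ≤ m⁻¹ * |a - b| := by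
  wlog hab : b ≤ a generalizing a b
  · rw [abs_sub_comm, abs_sub_comm a]
    exact this (by rwa [Set.uIcc_comm]) (le_of_not_ge hab)
  rw [abs_of_nonneg (sub_nonneg.2 hab)]
  refine abs_gaussCDF_one_sub_le_of_pdf_le hab (by positivity) fun x hx => ?_
  have hmx := h x (Set.Icc_subset_uIcc' ⟨hx.1.le, hx.2⟩)
  rw [← one_div, le_div_iff₀ hm, mul_comm]
  exact (mul_le_mul_of_nonneg_right hmx (gaussianPDFReal_nonneg _ _ _)).trans
    (abs_mul_gaussianPDFReal_le_one x)

lemma half_abs_le_abs_of_mem_uIcc {s t x : ℝ} (hs : 0 < s) (hs2 : s ≤ 2)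
    (hx : x ∈ Set.uIcc (t / s) t) : |t| / 2 ≤ |x| := by
  have hq : t / s * s = t := div_mul_cancel₀ t hs.ne'
  rcases le_total 0 t with ht | ht
  · have hq0 : 0 ≤ t / s := by positivity
    rw [abs_of_nonneg ht]
    refine le_trans ?_ (le_abs_self x)
    rcases Set.mem_uIcc.1 hx with h | h <;> nlinarith
  · have hq0 : t / s ≤ 0 := div_nonpos_of_nonpos_of_nonneg ht hs.le
    rw [abs_of_nonpos ht]
    refine le_trans ?_ (neg_le_abs x)
    rcases Set.mem_uIcc.1 hx with h | h <;> nlinarith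

/-- The Kolmogorov distance between centered Gaussians of variances `s²` and `1`. -/
lemma abs_gaussCDF_sq_sub_gaussCDF_one_le (s : ℝ) (hs : 0 ≤ s) (t : ℝ) :
    |gaussCDF (Real.toNNReal (s ^ 2)) t - gaussCDF 1 t| ≤ 35 / 8 * |s ^ 2 - 1| := by
  by_cases hfar : 8 / 35 ≤ |s ^ 2 - 1|
  · exact (abs_gaussCDF_sub_le_one _ _ _).trans (by linarith)
  have hnear := abs_lt.1 (not_le.1 hfar)
  have hs1 : 4 / 5 ≤ s := by nlinarith
  have hs2 : s ≤ 2 := by nlinarith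
  have hs0 : 0 < s := by linarith
  rw [gaussCDF_sq s hs0]
  rcases eq_or_ne t 0 with rfl | ht
  · simp
  have ht' : 0 < |t| := abs_pos.2 ht
  refine (abs_gaussCDF_one_sub_le (half_pos ht')
    fun x hx => half_abs_le_abs_of_mem_uIcc hs0 hs2 hx).trans ?_
  have hsub : t / s - t = t * ((1 - s ^ 2) / (s * (1 + s))) := by
    field_simp
    ring
  have hden : 0 < s * (1 + s) := by positivity
  rw [hsub, abs_mul, abs_div, abs_of_pos hden, abs_sub_comm 1]
  have hconst : 2 / (s * (1 + s)) ≤ 35 / 8 := by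
    rw [div_le_iff₀ hden]
    nlinarith
  calc (|t| / 2)⁻¹ * (|t| * (|s ^ 2 - 1| / (s * (1 + s))))
      = 2 / (s * (1 + s)) * |s ^ 2 - 1| := by field_simp
    _ ≤ 35 / 8 * |s ^ 2 - 1| := mul_le_mul_of_nonneg_right hconst (abs_nonneg _)

/-- Inequality (4.10): the expected Kolmogorov distance between a centered
Gaussian with random variance `V²` and the standard Gaussian is at most
`(35/8) E|V² - 1|`. -/
theorem kolmogorov_dist_random_variance_gaussian
    {Ω : Type} {mΩ : MeasurableSpace Ω} (μ : Measure Ω) [IsProbabilityMeasure μ]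
    (V : Ω → ℝ) (hV : Measurable V) (hVpos : ∀ ω, 0 ≤ V ω)
    (hV2 : Integrable (fun ω => (V ω) ^ 2) μ) :
    (∫ ω, (⨆ t : ℝ, |gaussCDF (Real.toNNReal ((V ω) ^ 2)) t - gaussCDF 1 t|) ∂μ) ≤
      (35 / 8) * ∫ ω, |(V ω) ^ 2 - 1| ∂μ := by
  rw [← integral_const_mul]
  refine integral_mono_of_nonneg ?_ ?_ ?_
  · exact .of_forall fun ω => Real.iSup_nonneg fun t => abs_nonneg _
  · exact ((hV2.sub (integrable_const 1)).abs).const_mul _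
  · exact .of_forall fun ω => ciSup_le (abs_gaussCDF_sq_sub_gaussCDF_one_le (V ω) (hVpos ω))
end

section
/- Let n ≥ 2, let b_1^2,...,b_n^2 be nonnegative reals with Σ_{k=1}^n b_k^2 = n, and let θ = (θ_1,...,θ_n) be uniformly distributed on the unit sphere S^{n-1} of R^n. Then ‖ Σ_{k=1}^n θ_k^2 b_k^2 − 1 ‖_{L^2} ≤ 2√5 · ( Σ_{k=1}^n (b_k^2 − 1)^2 )^{1/2} / (n − 1), and consequently the same bound holds for ‖ Σ_{k=1}^n θ_k^2 b_k^2 − 1 ‖_{L^1}. -/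
open MeasureTheory ProbabilityTheory Finset
open scoped NNReal ENNReal

/-- The uniform (rotation invariant) probability measure on the unit sphere
`S^{n-1}` of `ℝ^n`, obtained by normalizing the spherical part of the Lebesgue
measure. -/
noncomputable def sphereUniform (n : ℕ) :
    Measure (Metric.sphere (0 : EuclideanSpace ℝ (Fin n)) 1) :=
  ((volume : Measure (EuclideanSpace ℝ (Fin n))).toSphere Set.univ)⁻¹ •
    (volume : Measure (EuclideanSpace ℝ (Fin n))).toSphere

open scoped Pointwise in
theorem toSphere_map_linearIsometryEquiv {n : ℕ}
    (L : EuclideanSpace ℝ (Fin n) ≃ₗᵢ[ℝ] EuclideanSpace ℝ (Fin n))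
    (T : Metric.sphere (0 : EuclideanSpace ℝ (Fin n)) 1 →
      Metric.sphere (0 : EuclideanSpace ℝ (Fin n)) 1)
    (hT : ∀ u, (T u : EuclideanSpace ℝ (Fin n)) = L u) (hTm : Measurable T) :
    (volume : Measure (EuclideanSpace ℝ (Fin n))).toSphere.map T =
      (volume : Measure (EuclideanSpace ℝ (Fin n))).toSphere := by
  ext s hs
  rw [Measure.map_apply hTm hs, Measure.toSphere_apply' _ (hTm hs), Measure.toSphere_apply' _ hs,
    ← L.measurePreserving.measure_preimage_equiv (f := L.toMeasurableEquiv)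
      (Set.Ioo (0 : ℝ) 1 • (Subtype.val '' s))]
  congr 2
  ext x
  simp only [Set.mem_smul, Set.mem_image, Set.mem_preimage]
  constructor
  · rintro ⟨r, hr, _, ⟨u, hu, rfl⟩, rfl⟩
    exact ⟨r, hr, _, ⟨T u, hu, rfl⟩, by simp [hT]⟩
  · rintro ⟨r, hr, _, ⟨u, hu, rfl⟩, h⟩
    have hv : L.symm u ∈ Metric.sphere (0 : EuclideanSpace ℝ (Fin n)) 1 := by
      simp
    have hTv : T ⟨L.symm u, hv⟩ = u := Subtype.ext (by simp [hT])
    refine ⟨r, hr, _, ⟨⟨L.symm u, hv⟩, by simpa [hTv] using hu, rfl⟩, ?_⟩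
    apply L.injective
    simpa using h

theorem integral_sphereUniform_comp {n : ℕ}
    (L : EuclideanSpace ℝ (Fin n) ≃ₗᵢ[ℝ] EuclideanSpace ℝ (Fin n))
    {f : EuclideanSpace ℝ (Fin n) → ℝ} (hf : Continuous f) :
    ∫ u, f (L u) ∂(sphereUniform n) = ∫ u, f u ∂(sphereUniform n) := by
  let T : Metric.sphere (0 : EuclideanSpace ℝ (Fin n)) 1 →
      Metric.sphere (0 : EuclideanSpace ℝ (Fin n)) 1 := fun u => ⟨L u, by simp⟩
  have hT : Continuous T := by fun_prop
  have h : (sphereUniform n).map T = sphereUniform n := by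
    rw [sphereUniform, Measure.map_smul,
      toSphere_map_linearIsometryEquiv L T (fun _ => rfl) hT.measurable]
  conv_rhs => rw [← h]
  rw [integral_map hT.aemeasurable (by fun_prop)]

theorem isProbabilityMeasure_sphereUniform {n : ℕ} (hn : n ≠ 0) :
    IsProbabilityMeasure (sphereUniform n) := by
  have : NeZero n := ⟨hn⟩
  have : NeZero (volume : Measure (EuclideanSpace ℝ (Fin n))).toSphere :=
    ⟨Measure.toSphere_ne_zero _⟩
  exact isProbabilityMeasureSMul

theorem integral_inner_pow_sphereUniform_congr {n : ℕ} (m : ℕ) {x y : EuclideanSpace ℝ (Fin n)}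
    (hxy : ‖x‖ = ‖y‖) :
    ∫ u, (inner ℝ x (u : EuclideanSpace ℝ (Fin n))) ^ m ∂(sphereUniform n) =
      ∫ u, (inner ℝ y (u : EuclideanSpace ℝ (Fin n))) ^ m ∂(sphereUniform n) := by
  rw [← integral_sphereUniform_comp (Submodule.reflection (ℝ ∙ (x - y))ᗮ)
    (f := fun u => (inner ℝ y u) ^ m) (by fun_prop)]
  congr with u
  conv_lhs => rw [← (Submodule.reflection (ℝ ∙ (x - y))ᗮ).inner_map_map,
    Submodule.reflection_sub hxy]

theorem integrable_sphere_of_continuous {n : ℕ}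
    {μ : Measure (Metric.sphere (0 : EuclideanSpace ℝ (Fin n)) 1)} [IsFiniteMeasure μ]
    {f : Metric.sphere (0 : EuclideanSpace ℝ (Fin n)) 1 → ℝ} (hf : Continuous f) :
    Integrable f μ :=
  hf.integrable_of_hasCompactSupport (HasCompactSupport.of_compactSpace f)

theorem integral_coord_sq_mul_sq_sphereUniform {n : ℕ} (hn : n ≠ 0) (i j : Fin n) :
    ∫ u, (u : EuclideanSpace ℝ (Fin n)) i ^ 2 * (u : EuclideanSpace ℝ (Fin n)) j ^ 2
      ∂(sphereUniform n) = (if i = j then 3 else 1) / (n * (n + 2)) := by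
  have := isProbabilityMeasure_sphereUniform hn
  set M : ℝ := ∫ u, (u : EuclideanSpace ℝ (Fin n)) i ^ 4 ∂(sphereUniform n) with hM
  have diag (k : Fin n) : ∫ u, (u : EuclideanSpace ℝ (Fin n)) k ^ 4 ∂(sphereUniform n) = M := by
    simpa [EuclideanSpace.inner_single_left] using integral_inner_pow_sphereUniform_congr 4
      (x := EuclideanSpace.single k (1 : ℝ)) (y := EuclideanSpace.single i (1 : ℝ)) (by simp)
  have off (k l : Fin n) (hkl : k ≠ l) :
      ∫ u, (u : EuclideanSpace ℝ (Fin n)) k ^ 2 * (u : EuclideanSpace ℝ (Fin n)) l ^ 2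
        ∂(sphereUniform n) = M / 3 := by
    have key (c : ℝ) (hc : c ^ 2 = 1) :
        ∫ u, ((u : EuclideanSpace ℝ (Fin n)) k + c * (u : EuclideanSpace ℝ (Fin n)) l) ^ 4
          ∂(sphereUniform n) = 4 * M := by
      have hnorm : ‖EuclideanSpace.single k (1 : ℝ) + EuclideanSpace.single l c‖ =
          ‖EuclideanSpace.single i (√2 : ℝ)‖ := by
        rw [← sq_eq_sq₀ (norm_nonneg _) (norm_nonneg _), norm_add_sq_real]
        simp [EuclideanSpace.inner_single_left, hkl, hc]
        norm_num
      have h := integral_inner_pow_sphereUniform_congr 4 hnorm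
      have h4 : √2 ^ 4 = (4 : ℝ) := by
        rw [show 4 = 2 * 2 from rfl, pow_mul]; norm_num
      simpa [inner_add_left, EuclideanSpace.inner_single_left, mul_pow, h4,
        integral_const_mul, ← hM] using h
    have hsum : ∫ u, (((u : EuclideanSpace ℝ (Fin n)) k + 1 * (u : EuclideanSpace ℝ (Fin n)) l) ^ 4
        + ((u : EuclideanSpace ℝ (Fin n)) k + (-1) * (u : EuclideanSpace ℝ (Fin n)) l) ^ 4)
          ∂(sphereUniform n) = 8 * M := by
      rw [integral_add (integrable_sphere_of_continuous (by fun_prop))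
        (integrable_sphere_of_continuous (by fun_prop)), key 1 (by norm_num), key (-1) (by norm_num)]
      ring
    have hexp : ∫ u, (2 * (u : EuclideanSpace ℝ (Fin n)) k ^ 4
        + 2 * (u : EuclideanSpace ℝ (Fin n)) l ^ 4
        + 12 * ((u : EuclideanSpace ℝ (Fin n)) k ^ 2 * (u : EuclideanSpace ℝ (Fin n)) l ^ 2))
          ∂(sphereUniform n) = 8 * M := by
      rw [← hsum]
      congr with u
      ring
    rw [integral_add (integrable_sphere_of_continuous (by fun_prop))
        (integrable_sphere_of_continuous (by fun_prop)),
      integral_add (integrable_sphere_of_continuous (by fun_prop))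
        (integrable_sphere_of_continuous (by fun_prop)), integral_const_mul, integral_const_mul,
        integral_const_mul, diag, diag] at hexp
    linarith
  have all (k l : Fin n) :
      ∫ u, (u : EuclideanSpace ℝ (Fin n)) k ^ 2 * (u : EuclideanSpace ℝ (Fin n)) l ^ 2
        ∂(sphereUniform n) = M / 3 + if k = l then 2 * M / 3 else 0 := by
    split_ifs with h
    · subst h
      rw [← diag k]
      simp only [← pow_add]
      norm_num
      ring
    · rw [off k l h, add_zero]
  have total : (1 : ℝ) = n * (n + 2) * (M / 3) := by
    calc (1 : ℝ) = ∫ _, (1 : ℝ) ∂(sphereUniform n) := by simp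
      _ = ∫ u, ∑ k, ∑ l, (u : EuclideanSpace ℝ (Fin n)) k ^ 2 *
            (u : EuclideanSpace ℝ (Fin n)) l ^ 2 ∂(sphereUniform n) := by
          congr with u
          have hu : ∑ k, (u : EuclideanSpace ℝ (Fin n)) k ^ 2 = 1 := by
            rw [← EuclideanSpace.real_norm_sq_eq]; simp
          rw [← Finset.sum_mul_sum, hu, one_mul]
      _ = ∑ k : Fin n, ∑ l : Fin n, (M / 3 + if k = l then 2 * M / 3 else 0) := by
          rw [integral_finsetSum _ fun k _ => integrable_sphere_of_continuous (by fun_prop)]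
          refine Finset.sum_congr rfl fun k _ => ?_
          rw [integral_finsetSum _ fun l _ => integrable_sphere_of_continuous (by fun_prop)]
          exact Finset.sum_congr rfl fun l _ => all k l
      _ = n * (n + 2) * (M / 3) := by
          simp [Finset.sum_add_distrib]
          ring
  have hn0 : (0 : ℝ) < n := by positivity
  rw [all, eq_div_iff (by positivity)]
  split_ifs <;> linarith

theorem integral_sq_sum_coord_sq_mul_sphereUniform {n : ℕ} (hn : n ≠ 0) (a : Fin n → ℝ)
    (ha : ∑ k, a k = 0) :
    ∫ u, (∑ k, (u : EuclideanSpace ℝ (Fin n)) k ^ 2 * a k) ^ 2 ∂(sphereUniform n) =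
      2 * (∑ k, a k ^ 2) / (n * (n + 2)) := by
  have := isProbabilityMeasure_sphereUniform hn
  calc _ = ∫ u, ∑ k, ∑ l, a k * a l * ((u : EuclideanSpace ℝ (Fin n)) k ^ 2 *
            (u : EuclideanSpace ℝ (Fin n)) l ^ 2) ∂(sphereUniform n) := by
        congr with u
        rw [sq, Finset.sum_mul_sum]
        exact Finset.sum_congr rfl fun k _ => Finset.sum_congr rfl fun l _ => by ring
    _ = ∑ k : Fin n, ∑ l : Fin n,
          (a k * a l / (n * (n + 2)) + if k = l then 2 * a k ^ 2 / (n * (n + 2)) else 0) := by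
        rw [integral_finsetSum _ fun k _ => integrable_sphere_of_continuous (by fun_prop)]
        refine Finset.sum_congr rfl fun k _ => ?_
        rw [integral_finsetSum _ fun l _ => integrable_sphere_of_continuous (by fun_prop)]
        refine Finset.sum_congr rfl fun l _ => ?_
        rw [integral_const_mul, integral_coord_sq_mul_sq_sphereUniform hn]
        split_ifs with h
        · subst h; ring
        · ring
    _ = _ := by
        simp [Finset.sum_add_distrib, ← Finset.sum_div, ← Finset.mul_sum, ha]

/-- Inequality (4.11): second order concentration on the sphere for
`v(θ) = Σ θ_k² b_k² - 1`, in `L²` and hence in `L¹`. -/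
theorem sphere_second_order_concentration (n : ℕ) (hn : 2 ≤ n)
    (b2 : Fin n → ℝ) (hb2 : ∀ k, 0 ≤ b2 k) (hsum : ∑ k, b2 k = (n : ℝ)) :
    Real.sqrt (∫ u : Metric.sphere (0 : EuclideanSpace ℝ (Fin n)) 1,
        ((∑ k, ((u : EuclideanSpace ℝ (Fin n)) k) ^ 2 * b2 k) - 1) ^ 2 ∂(sphereUniform n)) ≤
      2 * Real.sqrt 5 * Real.sqrt (∑ k, (b2 k - 1) ^ 2) / (n - 1) ∧
    (∫ u : Metric.sphere (0 : EuclideanSpace ℝ (Fin n)) 1,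
        |(∑ k, ((u : EuclideanSpace ℝ (Fin n)) k) ^ 2 * b2 k) - 1| ∂(sphereUniform n)) ≤
      2 * Real.sqrt 5 * Real.sqrt (∑ k, (b2 k - 1) ^ 2) / (n - 1) := by
  have hn0 : n ≠ 0 := by lia
  have := isProbabilityMeasure_sphereUniform hn0
  have hn1 : (0 : ℝ) < n - 1 := by
    have : (2 : ℝ) ≤ n := by exact_mod_cast hn
    linarith
  set S : ℝ := ∑ k, (b2 k - 1) ^ 2
  have hS0 : 0 ≤ S := Finset.sum_nonneg fun k _ => sq_nonneg _
  have hv (u : Metric.sphere (0 : EuclideanSpace ℝ (Fin n)) 1) :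
      (∑ k, ((u : EuclideanSpace ℝ (Fin n)) k) ^ 2 * b2 k) - 1 =
        ∑ k, ((u : EuclideanSpace ℝ (Fin n)) k) ^ 2 * (b2 k - 1) := by
    have hu : ∑ k, (u : EuclideanSpace ℝ (Fin n)) k ^ 2 = 1 := by
      rw [← EuclideanSpace.real_norm_sq_eq]; simp
    simp [mul_sub, Finset.sum_sub_distrib, hu]
  have hL2 : Real.sqrt (∫ u : Metric.sphere (0 : EuclideanSpace ℝ (Fin n)) 1,
        ((∑ k, ((u : EuclideanSpace ℝ (Fin n)) k) ^ 2 * b2 k) - 1) ^ 2 ∂(sphereUniform n)) ≤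
      2 * Real.sqrt 5 * Real.sqrt S / (n - 1) := by
    simp_rw [hv]
    rw [integral_sq_sum_coord_sq_mul_sphereUniform hn0 _ (by simp [hsum])]
    refine Real.sqrt_le_iff.2 ⟨by positivity, ?_⟩
    rw [div_pow, mul_pow, mul_pow, Real.sq_sqrt (by norm_num), Real.sq_sqrt hS0]
    have h1 : (n - 1 : ℝ) ^ 2 ≤ n * (n + 2) := by nlinarith
    gcongr ?_ / ?_
    linarith
  refine ⟨hL2, le_trans ?_ hL2⟩
  have hc : Continuous fun u : Metric.sphere (0 : EuclideanSpace ℝ (Fin n)) 1 =>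
      |(∑ k, ((u : EuclideanSpace ℝ (Fin n)) k) ^ 2 * b2 k) - 1| := by fun_prop
  apply Real.le_sqrt_of_sq_le
  have h := variance_nonneg (fun u : Metric.sphere (0 : EuclideanSpace ℝ (Fin n)) 1 =>
      |(∑ k, ((u : EuclideanSpace ℝ (Fin n)) k) ^ 2 * b2 k) - 1|) (sphereUniform n)
  rw [variance_eq_sub ((memLp_two_iff_integrable_sq hc.aestronglyMeasurable).2
    (integrable_sphere_of_continuous (hc.pow 2)))] at h
  simpa using h
end
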